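/- Let n ≥ 5 and let d be the number of derangements in the alternating group Alt(n) acting naturally on {1,…,n}. For every irreducible complex character φ of Alt(n), the eigenvalue λ_φ = (1/φ(1)) · Σ_{σ ∈ Der} φ(σ) (sum over derangements σ of Alt(n)) satisfies: λ_φ = −d/(n−1) only when φ is the standard character ψ given by ψ(σ) = fix(σ) − 1, and λ_φ = d only when φ is the trivial character; for all other irreducible characters φ, −d/(n−1) < λ_φ < d. In particular, the least eigenvalue of the derangement graph of Alt(n) is afforded only by ψ and the largest only by the trivial character. -/

import Mathlib

/-- every nontrivial complex representation of `Alt α` has dimension at least `m` -/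
def DimGe (α : Type) [Fintype α] [DecidableEq α] (m : ℕ) : Prop :=
  ∀ (V : Type) [AddCommGroup V] [Module ℂ V] [FiniteDimensional ℂ V]
    (ρ : alternatingGroup α →* Module.End ℂ V), (∃ g, ρ g ≠ 1) → m ≤ Module.finrank ℂ V

theorem alt_faithful {α : Type} [Fintype α] [DecidableEq α] (hα : 5 ≤ Fintype.card α)
    {M : Type} [Monoid M] (ρ : alternatingGroup α →* M) (h : ∃ g, ρ g ≠ 1)
    (g : alternatingGroup α) (hg : ρ g = 1) : g = 1 := by
  have hs : IsSimpleGroup (alternatingGroup α) := alternatingGroup.isSimpleGroup (by simpa using hα)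
  rcases hs.eq_bot_or_eq_top_of_normal ρ.ker inferInstance with h1 | h1
  · have : g ∈ ρ.ker := hg
    rw [h1] at this
    simpa using this
  · obtain ⟨k, hk⟩ := h
    exfalso
    apply hk
    have : k ∈ ρ.ker := by rw [h1]; trivial
    exact this

/-- the embedding of alternating groups -/
def altInl (α β : Type) [Fintype α] [DecidableEq α] [Fintype β] [DecidableEq β] :
    alternatingGroup α →* alternatingGroup (α ⊕ β) where
  toFun g := ⟨Equiv.Perm.sumCongr g.1 1, by
    rw [Equiv.Perm.mem_alternatingGroup, Equiv.Perm.sign_sumCongr, g.2]; simp⟩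
  map_one' := by ext x; cases x <;> simp
  map_mul' a b := by ext x; cases x <;> simp

theorem altInl_inj {α β : Type} [Fintype α] [DecidableEq α] [Fintype β] [DecidableEq β]
    (g : alternatingGroup α) (h : altInl α β g = 1) : g = 1 := by
  ext x
  have := congrArg (fun k : alternatingGroup (α ⊕ β) => k.1 (Sum.inl x)) h
  simpa [altInl] using this

theorem DimGe.congr {α β : Type} [Fintype α] [DecidableEq α] [Fintype β] [DecidableEq β]
    {m : ℕ} (e : α ≃ β) (h : DimGe α m) : DimGe β m := by
  intro V _ _ _ ρ ⟨g, hg⟩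
  refine h V (ρ.comp (Equiv.altCongrHom e).toMonoidHom) ⟨(Equiv.altCongrHom e).symm g, ?_⟩
  simpa using hg

theorem exists_ne_one_alt {α : Type} [Fintype α] [DecidableEq α] (hα : 5 ≤ Fintype.card α) :
    ∃ g : alternatingGroup α, g ≠ 1 := by
  have hs : IsSimpleGroup (alternatingGroup α) := alternatingGroup.isSimpleGroup (by simpa using hα)
  exact exists_ne 1

theorem DimGe.mono {α : Type} (β : Type) [Fintype α] [DecidableEq α] [Fintype β] [DecidableEq β]
    {m : ℕ} (hα : 5 ≤ Fintype.card α) (h : DimGe α m) : DimGe (α ⊕ β) m := by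
  intro V _ _ _ ρ hρ
  obtain ⟨g, hg⟩ := exists_ne_one_alt hα
  refine h V (ρ.comp (altInl α β)) ⟨g, fun h1 => hg ?_⟩
  apply altInl_inj (β := β)
  exact alt_faithful (by simp; omega) ρ hρ _ h1

/-- restriction to an eigenspace of a commuting operator -/
noncomputable def restrEig {G V : Type} [Group G] [AddCommGroup V] [Module ℂ V]
    (ρ : G →* Module.End ℂ V) (T : Module.End ℂ V) (hT : ∀ g, Commute T (ρ g)) (w : ℂ) :
    G →* Module.End ℂ (T.eigenspace w) where
  toFun g := (ρ g).restrict (p := T.eigenspace w) (q := T.eigenspace w) (by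
    intro x hx
    rw [Module.End.mem_eigenspace_iff] at hx ⊢
    have := congrArg (fun f : Module.End ℂ V => f x) (hT g).eq
    simp only [Module.End.mul_apply, hx, map_smul] at this
    exact this)
  map_one' := by ext x; simp
  map_mul' a b := by ext x; simp

theorem DimGe.step {α : Type} [Fintype α] [DecidableEq α] {m : ℕ} (hα : 5 ≤ Fintype.card α)
    (hm : 2 ≤ m) (h : DimGe α m) : DimGe (α ⊕ Fin 3) (m + 2) := by
  intro V _ _ _ ρ hρ
  have hc' : 5 ≤ Fintype.card (α ⊕ Fin 3) := by simp; omega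
  have hf := alt_faithful hc' ρ hρ
  obtain ⟨x, y, hxy⟩ : ∃ x y : α, x ≠ y := by
    have : Nontrivial α := Fintype.one_lt_card_iff_nontrivial.1 (by omega)
    exact exists_pair_ne α
  let c : alternatingGroup (α ⊕ Fin 3) := ⟨Equiv.Perm.sumCongr 1 (finRotate 3), by
    rw [Equiv.Perm.mem_alternatingGroup, Equiv.Perm.sign_sumCongr]; simp⟩
  let t : alternatingGroup (α ⊕ Fin 3) := ⟨Equiv.Perm.sumCongr (Equiv.swap x y) (Equiv.swap 0 1), by
    rw [Equiv.Perm.mem_alternatingGroup, Equiv.Perm.sign_sumCongr, Equiv.Perm.sign_swap hxy,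
      Equiv.Perm.sign_swap (by decide)]; simp⟩
  have hc3 : c ^ 3 = 1 := by
    ext z
    rcases z with z | z
    · simp [c, pow_succ]
    · fin_cases z <;> simp [c, pow_succ]
  have hc1 : c ≠ 1 := by
    intro h
    have := congrArg (fun k : alternatingGroup (α ⊕ Fin 3) => k.1 (Sum.inr 0)) h
    simp [c] at this
  have htc : c * t * c = t := by
    ext z
    rcases z with z | z
    · simp [c, t]
    · fin_cases z <;> simp [c, t] <;> decide
  have hcomm : ∀ g, c * altInl α (Fin 3) g = altInl α (Fin 3) g * c := by
    intro g
    ext z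
    rcases z with z | z <;> simp [c, altInl]
  let T := ρ c
  have hT3 : ∀ v, T (T (T v)) = v := by
    intro v
    have : (ρ c) ^ 3 = 1 := by rw [← map_pow, hc3, map_one]
    have := congrArg (fun f : Module.End ℂ V => f v) this
    simpa [pow_succ] using this
  obtain ⟨w, hw⟩ : ∃ w : ℂ, IsPrimitiveRoot w 3 := ⟨_, Complex.isPrimitiveRoot_exp 3 (by norm_num)⟩
  have hw3 : w ^ 3 = 1 := hw.pow_eq_one
  have hw1 : w ≠ 1 := hw.ne_one (by norm_num)
  have hws : 1 + w + w ^ 2 = 0 := by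
    have : (w - 1) * (1 + w + w ^ 2) = 0 := by linear_combination hw3
    exact (mul_eq_zero.1 this).resolve_left (sub_ne_zero.2 hw1)
  have hw0 : w ≠ 0 := hw.ne_zero (by norm_num)
  have hw2 : w ^ 2 ≠ 1 := by
    intro h2
    apply hw1
    calc w = w ^ 2 * w := by rw [h2, one_mul]
      _ = 1 := by linear_combination hw3
  have hww : w ^ 2 ≠ w := by
    intro h2
    apply hw1
    have : w * (w - 1) = 0 := by linear_combination h2
    exact sub_eq_zero.1 ((mul_eq_zero.1 this).resolve_left hw0)
  have hTc : ∀ g, Commute T ((ρ.comp (altInl α (Fin 3))) g) := by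
    intro g
    show ρ c * ρ (altInl α (Fin 3) g) = ρ (altInl α (Fin 3) g) * ρ c
    rw [← map_mul, ← map_mul, hcomm]
  -- projections
  have hE : ∀ z : ℂ, z ^ 3 = 1 → ∀ v, v + z ^ 2 • T v + z • T (T v) ∈ T.eigenspace z := by
    intro z hz v
    rw [Module.End.mem_eigenspace_iff]
    simp only [map_add, map_smul, hT3, smul_add, smul_smul]
    have h1 : z * z ^ 2 = 1 := by linear_combination hz
    have h2 : z * z = z ^ 2 := by ring
    rw [h1, h2]
    module
  have hdec : ∀ v, v = (1/3 : ℂ) • ((v + (1:ℂ) ^ 2 • T v + (1:ℂ) • T (T v)) +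
      (v + w ^ 2 • T v + w • T (T v)) + (v + (w ^ 2) ^ 2 • T v + (w ^ 2) • T (T v))) := by
    intro v
    have h4 : (w ^ 2) ^ 2 = w := by linear_combination w * hw3
    have h5 : w ^ 2 = - 1 - w := by linear_combination hws
    rw [h4, h5]
    module
  have hw23 : (w ^ 2) ^ 3 = 1 := by linear_combination (w ^ 3 + 1) * hw3
  -- dimensions
  have hdim : Module.finrank ℂ (T.eigenspace 1) + Module.finrank ℂ (T.eigenspace w) +
      Module.finrank ℂ (T.eigenspace (w ^ 2)) ≤ Module.finrank ℂ V := by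
    let L : (T.eigenspace 1 × T.eigenspace w × T.eigenspace (w ^ 2)) →ₗ[ℂ] V :=
      (T.eigenspace 1).subtype.coprod ((T.eigenspace w).subtype.coprod (T.eigenspace (w ^ 2)).subtype)
    have hL : Function.Injective L := by
      rw [injective_iff_map_eq_zero]
      rintro ⟨⟨x, hx⟩, ⟨y, hy⟩, ⟨z, hz⟩⟩ hxyz
      have k1 : x + y + z = 0 := by
        have : x + (y + z) = 0 := by simpa [L] using hxyz
        rw [add_assoc]; exact this
      rw [Module.End.mem_eigenspace_iff] at hx hy hz
      have k2 := congrArg T k1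
      simp only [map_add, hx, hy, hz, map_zero] at k2
      have k3 := congrArg T k2
      simp only [map_add, hx, hy, hz, map_zero, map_smul] at k3
      have h5 : w ^ 2 = - 1 - w := by linear_combination hws
      have h6 : w * w = -1 - w := by linear_combination hws
      have h7 : (-1 - w) * (-1 - w) = w := by linear_combination hws
      simp only [h5, smul_smul, h6, h7, one_smul] at k2 k3
      have ex : x = 0 := by
        have : (3 : ℂ) • x = (x + y + z) + (x + w • y + (-1 - w) • z) + (x + (-1 - w) • y + w • z) := by
          module
        rw [k1, k2, k3] at this
        simpa using this
      rw [ex, zero_add] at k1 k2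
      have ey : y = 0 := by
        have h8 : ((-1 - w) - w) • y = (-1 - w) • (y + z) - (w • y + (-1 - w) • z) := by module
        rw [k1, k2, smul_zero, sub_zero] at h8
        refine (smul_eq_zero.1 h8).resolve_left ?_
        intro h9
        apply hww
        linear_combination h9 + h5
      have ez : z = 0 := by rw [ey, zero_add] at k1; exact k1
      subst ex ey ez
      rfl
    have := LinearMap.finrank_le_finrank_of_injective hL
    rw [Module.finrank_prod, Module.finrank_prod] at this
    omega
  -- w and w^2 eigenspaces have the same dimension
  have hsw : ∀ z z' : ℂ, z * z' = 1 → Module.finrank ℂ (T.eigenspace z) ≤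
      Module.finrank ℂ (T.eigenspace z') := by
    intro z z' hz
    have hinj : Function.Injective (ρ t) := by
      intro u v huv
      have h1 : ρ t⁻¹ * ρ t = 1 := by rw [← map_mul]; simp
      have h2 : ∀ u, (ρ t⁻¹) (ρ t u) = u := fun u => congrArg (fun f : Module.End ℂ V => f u) h1
      rw [← h2 u, huv, h2]
    have hmap : (T.eigenspace z).map (ρ t) ≤ T.eigenspace z' := by
      rintro _ ⟨v, hv, rfl⟩
      rw [SetLike.mem_coe, Module.End.mem_eigenspace_iff] at hv
      rw [Module.End.mem_eigenspace_iff]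
      have h1 : ρ c * ρ t * ρ c = ρ t := by rw [← map_mul, ← map_mul, htc]
      have h2 : T (ρ t (T v)) = ρ t v := congrArg (fun f : Module.End ℂ V => f v) h1
      rw [hv, map_smul, map_smul] at h2
      rw [← h2, smul_smul, mul_comm z', hz, one_smul, h2]
    calc _ = Module.finrank ℂ ((T.eigenspace z).map (ρ t)) :=
          (LinearEquiv.finrank_eq (Submodule.equivMapOfInjective _ hinj _))
      _ ≤ _ := Submodule.finrank_mono hmap
  have hd1 := hsw w (w ^ 2) (by linear_combination hw3)
  have hd2 := hsw (w ^ 2) w (by linear_combination hw3)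
  have hpos : 1 ≤ Module.finrank ℂ (T.eigenspace w) := by
    by_contra hcon
    have h1 : T.eigenspace w = ⊥ := by
      apply Submodule.finrank_eq_zero.1; omega
    have h2 : T.eigenspace (w ^ 2) = ⊥ := by
      apply Submodule.finrank_eq_zero.1; omega
    apply hc1
    apply hf
    ext v
    have e1 := hE w hw3 v
    have e2 := hE (w ^ 2) hw23 v
    rw [h1, Submodule.mem_bot] at e1
    rw [h2, Submodule.mem_bot] at e2
    have e3 := hE 1 (by simp) v
    have e4 := hdec v
    rw [e1, e2, add_zero, add_zero] at e4
    have e5 : v ∈ T.eigenspace 1 := by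
      rw [e4]; exact Submodule.smul_mem _ _ e3
    rw [Module.End.mem_eigenspace_iff, one_smul] at e5
    exact e5
  -- nontriviality on one of the eigenspaces
  obtain ⟨g, hg⟩ := exists_ne_one_alt hα
  have key : ∀ z : ℂ, (restrEig _ T hTc z g ≠ 1) → m ≤ Module.finrank ℂ (T.eigenspace z) :=
    fun z hz => h _ (restrEig _ T hTc z) ⟨g, hz⟩
  by_cases k0 : restrEig _ T hTc 1 g = 1
  swap
  · have := key _ k0; omega
  by_cases k1 : restrEig _ T hTc w g = 1
  swap
  · have := key _ k1; omega
  by_cases k2 : restrEig _ T hTc (w ^ 2) g = 1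
  swap
  · have := key _ k2; omega
  exfalso
  apply hg
  apply altInl_inj (β := Fin 3)
  apply hf
  have hfix : ∀ z : ℂ, restrEig _ T hTc z g = 1 → ∀ v ∈ T.eigenspace z,
      ρ (altInl α (Fin 3) g) v = v := by
    intro z hz v hv
    have := congrArg (fun f : Module.End ℂ (T.eigenspace z) => (f ⟨v, hv⟩ : V)) hz
    exact this
  ext v
  have e1 := hfix _ k0 _ (hE 1 (by simp) v)
  have e2 := hfix _ k1 _ (hE w hw3 v)
  have e3 := hfix _ k2 _ (hE (w ^ 2) hw23 v)
  rw [Module.End.one_apply]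
  conv_lhs => rw [hdec v]
  rw [map_smul, map_add, map_add, e1, e2, e3]
  exact (hdec v).symm

theorem DimGe.base : DimGe (Fin 5) 3 := by
  intro V _ _ _ ρ hρ
  have hf := alt_faithful (by simp) ρ hρ
  have hinj : Function.Injective ρ := by
    intro g h hgh
    have : ρ (g * h⁻¹) = 1 := by rw [map_mul, hgh, ← map_mul]; simp
    exact mul_inv_eq_one.1 (hf _ this)
  let a : alternatingGroup (Fin 5) := ⟨Equiv.swap 0 1 * Equiv.swap 2 3, by rw [Equiv.Perm.mem_alternatingGroup]; decide⟩
  let b : alternatingGroup (Fin 5) := ⟨Equiv.swap 0 2 * Equiv.swap 1 3, by rw [Equiv.Perm.mem_alternatingGroup]; decide⟩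
  let t : alternatingGroup (Fin 5) := ⟨Equiv.swap 2 3 * Equiv.swap 1 2, by rw [Equiv.Perm.mem_alternatingGroup]; decide⟩
  have haa : a * a = 1 := by decide
  have hab : a ≠ b := by decide
  have ha1 : a ≠ 1 := by decide
  have htb : t * b * t⁻¹ = a := by decide
  have htab : t * (a * b) * t⁻¹ = b := by decide
  clear_value a b t
  let D : alternatingGroup (Fin 5) →* ℂ := (LinearMap.det).comp ρ
  have hDconj : ∀ x y, D (x * y * x⁻¹) = D y := by
    intro x y
    have : D x * D x⁻¹ = 1 := by rw [← map_mul]; simp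
    rw [map_mul, map_mul]
    linear_combination D y * this
  have hDa : D a = 1 := by
    have h1 := hDconj t b
    have h2 := hDconj t (a * b)
    rw [htb] at h1
    rw [htab, map_mul] at h2
    have h3 : D a * D a = 1 := by rw [← map_mul, haa, map_one]
    have h4 : D b ≠ 0 := by
      rw [← h1]; intro h; rw [h] at h3; simp at h3
    exact mul_right_cancel₀ h4 (by rw [one_mul]; exact h2.symm)
  by_contra hlt
  have hcases : Module.finrank ℂ V = 0 ∨ Module.finrank ℂ V = 1 ∨ Module.finrank ℂ V = 2 := by omega
  rcases hcases with h0 | h0 | h0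
  · have : Subsingleton V := Module.finrank_zero_iff.1 h0
    obtain ⟨g, hg⟩ := hρ
    exact hg (LinearMap.ext fun v => Subsingleton.elim _ _)
  · let B := Module.finBasisOfFinrankEq ℂ V h0
    have h1 : (LinearMap.toMatrix B B (ρ a)).det = 1 := by
      rw [LinearMap.det_toMatrix]; exact hDa
    rw [Matrix.det_fin_one] at h1
    apply ha1
    apply hf
    apply (LinearMap.toMatrix B B).injective
    rw [LinearMap.toMatrix_one]
    ext i j
    fin_cases i; fin_cases j
    simpa using h1
  · let B := Module.finBasisOfFinrankEq ℂ V h0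
    let M := LinearMap.toMatrix B B (ρ a)
    have h1 : M.det = 1 := by
      rw [LinearMap.det_toMatrix]; exact hDa
    have h2 : M * M = 1 := by
      rw [← LinearMap.toMatrix_mul, ← map_mul, haa, map_one, LinearMap.toMatrix_one]
    have h3 : M = M.adjugate := by
      have := Matrix.mul_adjugate M
      rw [h1, one_smul] at this
      calc M = M * (M * M.adjugate) := by rw [this, mul_one]
        _ = _ := by rw [← mul_assoc, h2, one_mul]
    rw [Matrix.adjugate_fin_two] at h3
    have e00 : M 0 0 = M 1 1 := by
      have := congrFun (congrFun h3 0) 0; simpa using this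
    have e01 : M 0 1 = 0 := by
      have := congrFun (congrFun h3 0) 1
      simp at this
      exact self_eq_neg.1 this
    have e10 : M 1 0 = 0 := by
      have := congrFun (congrFun h3 1) 0
      simp at this
      exact self_eq_neg.1 this
    have hsc : M = (M 0 0) • 1 := by
      ext i j
      fin_cases i <;> fin_cases j <;> simp [e00, e01, e10]
    have hsc2 : ρ a = (M 0 0) • 1 := by
      apply (LinearMap.toMatrix B B).injective
      rw [map_smul, LinearMap.toMatrix_one]
      exact hsc
    apply hab
    apply hinj
    have h5 : ρ (t * b) = ρ (a * t) := by congr 1; rw [← htb]; group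
    have h6 : ρ (a * t) = ρ (t * a) := by
      rw [map_mul, map_mul, hsc2]; simp
    have h7 := hinj (h5.trans h6)
    rw [mul_left_cancel h7]

theorem DimGe.weaken {α : Type} [Fintype α] [DecidableEq α] {m m' : ℕ} (hm : m' ≤ m)
    (h : DimGe α m) : DimGe α m' := fun V _ _ _ ρ hρ => hm.trans (h V ρ hρ)

theorem dim_bound (n : ℕ) (hn : 5 ≤ n) : DimGe (Fin n) (max 3 (n / 2)) := by
  induction n using Nat.strong_induction_on with
  | _ n ih =>
    have hk : ∀ k, n = 5 + k → k ≤ 2 → DimGe (Fin n) (max 3 (n / 2)) := by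
      intro k hk hk2
      subst hk
      exact DimGe.weaken (by omega) (DimGe.congr finSumFinEquiv (DimGe.mono (Fin k) (by simp) DimGe.base))
    by_cases h : 8 ≤ n
    · obtain ⟨k, rfl⟩ : ∃ k, n = k + 3 := ⟨n - 3, by omega⟩
      have h1 := ih k (by omega) (by omega)
      exact DimGe.weaken (by omega) (DimGe.congr finSumFinEquiv (DimGe.step (by simp; omega) (by omega) h1))
    · exact hk (n - 5) (by omega) (by omega)

open scoped Classical ComplexOrder

theorem trace_inv_conj {G V : Type*} [Group G] [Fintype G] [AddCommGroup V] [Module ℂ V]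
    [FiniteDimensional ℂ V] (ρ : Representation ℂ G V) (g : G) :
    ρ.character g⁻¹ = star (ρ.character g) := by
  let b := Module.finBasis ℂ V
  let M : G → Matrix (Fin (Module.finrank ℂ V)) (Fin (Module.finrank ℂ V)) ℂ :=
    fun g => LinearMap.toMatrix b b (ρ g)
  have hM : ∀ g h, M (g * h) = M g * M h := by
    intro g h
    simp only [M, map_mul, LinearMap.toMatrix_mul]
  have hM1 : M 1 = 1 := by simp [M, LinearMap.toMatrix_one]
  have htr : ∀ g, ρ.character g = (M g).trace := by
    intro g
    exact LinearMap.trace_eq_matrix_trace ℂ b (ρ g)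
  let H := ∑ g, (M g).conjTranspose * M g
  have hH : H.PosDef := by
    have : H = 1 + ∑ g ∈ Finset.univ.erase (1 : G), (M g).conjTranspose * M g := by
      simp only [H]
      rw [← Finset.add_sum_erase _ _ (Finset.mem_univ (1 : G)), hM1]
      simp
    rw [this]
    apply Matrix.PosDef.add_posSemidef Matrix.PosDef.one
    apply Matrix.posSemidef_sum
    intro i _
    exact Matrix.posSemidef_conjTranspose_mul_self _
  have hinv : (M g).conjTranspose * H * M g = H := by
    simp only [H, Finset.mul_sum, Finset.sum_mul]
    rw [← Equiv.sum_comp (Equiv.mulRight g) (fun h => (M h).conjTranspose * M h)]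
    apply Finset.sum_congr rfl
    intro h _
    simp [hM, Matrix.mul_assoc]
  have hu : IsUnit H := hH.isUnit
  have hgi : M g * M g⁻¹ = 1 := by rw [← hM]; simp [hM1]
  have h2 : (M g).conjTranspose * H = H * M g⁻¹ := by
    calc (M g).conjTranspose * H = (M g).conjTranspose * H * (M g * M g⁻¹) := by rw [hgi, mul_one]
      _ = _ := by rw [← mul_assoc, hinv]
  have hdet : IsUnit H.det := (Matrix.isUnit_iff_isUnit_det _).1 hu
  have h3 : M g⁻¹ = H⁻¹ * ((M g).conjTranspose * H) := by
    rw [h2, ← mul_assoc, Matrix.nonsing_inv_mul _ hdet, one_mul]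
  rw [htr, htr, h3, Matrix.trace_mul_comm, mul_assoc, Matrix.mul_nonsing_inv _ hdet, mul_one,
    Matrix.trace_conjTranspose]

theorem perm_char {G X : Type*} [Group G] [Fintype X] [MulAction G X] (g : G) :
    (Representation.ofMulAction ℂ G X).character g = (Fintype.card (MulAction.fixedBy X g) : ℂ) := by
  unfold Representation.character
  rw [LinearMap.trace_eq_matrix_trace ℂ (MonoidAlgebra.basis X ℂ), Matrix.trace]
  have h : ∀ x : X, ((MonoidAlgebra.basis X ℂ).repr (MonoidAlgebra.single (g • x) 1)) x =
      if g • x = x then (1 : ℂ) else 0 := by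
    intro x
    exact Finsupp.single_apply
  simp only [Matrix.diag, LinearMap.toMatrix_apply, MonoidAlgebra.basis_apply,
    Representation.ofMulAction_single, h]
  rw [Finset.sum_boole, Fintype.card_subtype]
  rfl

theorem sum_char_fixed {G V X : Type*} [Group G] [Fintype G] [AddCommGroup V] [Module ℂ V]
    [FiniteDimensional ℂ V] (ρ : Representation ℂ G V) [Fintype X] [MulAction G X] :
    ∃ m : ℕ, ∑ g : G, ρ.character g * (Fintype.card (MulAction.fixedBy X g) : ℂ) =
      (Fintype.card G : ℂ) * m := by
  have h0 : (Nat.card G : ℂ) ≠ 0 := by simp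
  let _ := invertibleOfNonzero h0
  have hf : FiniteDimensional ℂ (MonoidAlgebra ℂ X) :=
    Module.Finite.of_basis (MonoidAlgebra.basis X ℂ)
  have h := Representation.card_inv_mul_sum_char_eq_finrank
    (ρ.tprod (Representation.ofMulAction ℂ G X))
  refine ⟨Module.finrank ℂ (ρ.tprod (Representation.ofMulAction ℂ G X)).invariants, ?_⟩
  · rw [← Nat.card_eq_fintype_card, ← h, mul_inv_cancel_left₀ h0]
    simp [perm_char]

theorem sum_normSq_char {G : Type} [Group G] [Fintype G] (V : FDRep ℂ G)
    (hV : CategoryTheory.Simple V) :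
    ∑ g : G, Complex.normSq (V.character g) = Fintype.card G := by
  have h0 : (Nat.card G : ℂ) ≠ 0 := by simp
  let _ := invertibleOfNonzero h0
  have h := FDRep.char_orthonormal V V
  have hc : ∀ g, V.character g⁻¹ = star (V.character g) := fun g => trace_inv_conj V.ρ g
  rw [if_pos ⟨CategoryTheory.Iso.refl _⟩, inv_mul_eq_iff_eq_mul₀ h0] at h
  simp only [hc, Complex.star_def, Complex.mul_conj] at h
  rw [Nat.card_eq_fintype_card, mul_one] at h
  exact_mod_cast h

/-- norm trick -/
theorem eq_of_inner {G : Type} [Fintype G] (f : G → ℂ) (p : G → ℝ)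
    (hf : ∑ g, Complex.normSq (f g) = Fintype.card G)
    (hp : ∑ g, (p g) ^ 2 = Fintype.card G) (m : ℕ)
    (hm : ∑ g, f g * (p g : ℂ) = (Fintype.card G : ℂ) * m) :
    m = 0 ∨ ∀ g, f g = p g := by
  by_cases hm0 : m = 0
  · exact Or.inl hm0
  right
  have h1 : ∑ g, (f g).re * p g = Fintype.card G * m := by
    have := congrArg Complex.re hm
    simpa using this
  have h2 : ∑ g, Complex.normSq (f g - p g) = 2 * Fintype.card G - 2 * (Fintype.card G * m) := by
    rw [← h1, Finset.mul_sum]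
    have : (2 : ℝ) * Fintype.card G = ∑ g, Complex.normSq (f g) + ∑ g, (p g) ^ 2 := by
      rw [hf, hp]; ring
    rw [this, ← Finset.sum_add_distrib, ← Finset.sum_sub_distrib]
    apply Finset.sum_congr rfl
    intro g _
    simp only [Complex.normSq_apply, Complex.sub_re, Complex.sub_im, Complex.ofReal_re, Complex.ofReal_im]
    ring
  have h3 : ∑ g, Complex.normSq (f g - p g) ≤ 0 := by
    rw [h2]
    have : (1 : ℝ) ≤ m := by exact_mod_cast Nat.one_le_iff_ne_zero.2 hm0
    have : (0 : ℝ) ≤ Fintype.card G := by positivity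
    nlinarith
  intro g
  have h4 : Complex.normSq (f g - p g) ≤ 0 :=
    (Finset.single_le_sum (f := fun g => Complex.normSq (f g - p g))
      (fun i _ => Complex.normSq_nonneg _) (Finset.mem_univ g)).trans h3
  have := Complex.normSq_eq_zero.1 (le_antisymm h4 (Complex.normSq_nonneg _))
  exact sub_eq_zero.1 this

/-- number of fixed points -/
noncomputable def fixN {n : ℕ} (σ : alternatingGroup (Fin n)) : ℕ :=
  (Finset.univ.filter fun i : Fin n => (σ : Equiv.Perm (Fin n)) i = i).card

theorem card_fixedBy_emb {n : ℕ} (k : ℕ) (σ : alternatingGroup (Fin n)) :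
    Fintype.card (MulAction.fixedBy (Fin k ↪ Fin n) σ) = (fixN σ).descFactorial k := by
  have e : MulAction.fixedBy (Fin k ↪ Fin n) σ ≃
      (Fin k ↪ {i : Fin n // (σ : Equiv.Perm (Fin n)) i = i}) :=
    { toFun := fun f => ⟨fun j => ⟨f.1 j, by
          have := f.2
          rw [MulAction.mem_fixedBy] at this
          exact DFunLike.congr_fun this j⟩, fun a b h => f.1.injective (congrArg Subtype.val h)⟩
      invFun := fun f => ⟨f.trans (Function.Embedding.subtype _), by
          rw [MulAction.mem_fixedBy]
          ext j
          exact congrArg Fin.val (f j).2⟩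
      left_inv := fun f => by ext; rfl
      right_inv := fun f => by ext; rfl }
  rw [Fintype.card_congr e, Fintype.card_embedding_eq, Fintype.card_fin, Fintype.card_subtype]
  rfl

theorem moment_low {n k : ℕ} (hk : k ≤ n - 2) :
    ∑ σ : alternatingGroup (Fin n), (fixN σ).descFactorial k =
      Fintype.card (alternatingGroup (Fin n)) := by
  have h := MulAction.sum_card_fixedBy_eq_card_orbits_mul_card_group (alternatingGroup (Fin n)) (Fin k ↪ Fin n)
  simp only [card_fixedBy_emb] at h
  rw [h]
  have h1 : MulAction.IsMultiplyPretransitive (alternatingGroup (Fin n)) (Fin n) (n - 2) := by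
    have := alternatingGroup.isMultiplyPretransitive (Fin n)
    simpa using this
  have h2 : MulAction.IsMultiplyPretransitive (alternatingGroup (Fin n)) (Fin n) k :=
    MulAction.isMultiplyPretransitive_of_le hk (by simp)
  have : Nonempty (Fin k ↪ Fin n) := ⟨Fin.castLEEmb (by omega)⟩
  have h3 : Fintype.card (Quotient (MulAction.orbitRel (alternatingGroup (Fin n)) (Fin k ↪ Fin n))) = 1 := by
    rw [Fintype.card_eq_one_iff_nonempty_unique]
    have : MulAction.IsPretransitive (alternatingGroup (Fin n)) (Fin k ↪ Fin n) := h2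
    have h5 := (MulAction.pretransitive_iff_subsingleton_quotient (alternatingGroup (Fin n)) (Fin k ↪ Fin n)).1 this
    obtain ⟨x⟩ := ‹Nonempty (Fin k ↪ Fin n)›
    exact ⟨@uniqueOfSubsingleton _ h5 (Quotient.mk _ x)⟩
  rw [h3, one_mul]

theorem fixN_one {n : ℕ} : fixN (1 : alternatingGroup (Fin n)) = n := by simp [fixN]

theorem moment_high {n k : ℕ} (hn : 2 ≤ n) (hk : n - 1 ≤ k) (hk' : k ≤ n) :
    ∑ σ : alternatingGroup (Fin n), (fixN σ).descFactorial k =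
      2 * Fintype.card (alternatingGroup (Fin n)) := by
  have : Nontrivial (Fin n) := Fin.nontrivial_iff_two_le.2 hn
  rw [Finset.sum_eq_single 1]
  · have := two_mul_card_alternatingGroup (α := Fin n)
    rw [fixN_one]
    have h2 : n.descFactorial k = n.factorial := by
      rcases (by omega : k = n ∨ k + 1 = n) with h | h
      · rw [h, Nat.descFactorial_self]
      · subst h
        rw [← Nat.descFactorial_self, Nat.descFactorial_succ]
        simp
    rw [h2]
    rw [Fintype.card_perm, Fintype.card_fin] at this
    rw [← this]
  · intro σ _ hσ
    rw [Nat.descFactorial_eq_zero_iff_lt]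
    have h1 : fixN σ + (σ : Equiv.Perm (Fin n)).support.card = n := by
      have := Finset.card_filter_add_card_filter_not (s := (Finset.univ : Finset (Fin n))) (fun i : Fin n => (σ : Equiv.Perm (Fin n)) i = i)
      rw [Finset.card_univ, Fintype.card_fin] at this
      refine Eq.trans ?_ this
      unfold fixN Equiv.Perm.support
      congr!
    have h2 : (σ : Equiv.Perm (Fin n)) ≠ 1 := by
      intro h; exact hσ (Subtype.ext h)
    have h3 : 2 ≤ (σ : Equiv.Perm (Fin n)).support.card := Equiv.Perm.two_le_card_support_of_ne_one h2
    omega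
  · simp

theorem cast_df (x k : ℕ) :
    ((x.descFactorial (k + 1) : ℕ) : ℝ) = ((x : ℝ) - k) * (x.descFactorial k : ℕ) := by
  rw [Nat.descFactorial_succ]
  rcases le_or_gt k x with h | h
  · push_cast [Nat.cast_sub h]; ring
  · rw [Nat.descFactorial_eq_zero_iff_lt.2 h]; simp

theorem bonferroni (x : ℕ) :
    ((x.descFactorial 0 : ℕ) : ℝ) - (x.descFactorial 1 : ℕ) + (x.descFactorial 2 : ℕ) / 2
      - (x.descFactorial 3 : ℕ) / 6 + (x.descFactorial 4 : ℕ) / 24 - (x.descFactorial 5 : ℕ) / 120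
      ≤ if x = 0 then 1 else 0 := by
  rcases x with _ | y
  · simp
  · have h : (0 : ℝ) ≤ ((y.descFactorial 5 : ℕ) : ℝ) := by positivity
    simp only [cast_df, Nat.descFactorial_zero] at h ⊢
    rw [if_neg (by omega)]
    push_cast at h ⊢
    nlinarith [h]

theorem sq_expand (x : ℕ) (θ : ℝ) :
    ((if x = 0 then (1 : ℝ) else 0) - θ * (5 / 2 * (x.descFactorial 0 : ℕ)
      - 2 * (x.descFactorial 1 : ℕ) + (x.descFactorial 2 : ℕ) / 2)) ^ 2 =
    (1 - 5 * θ) * (if x = 0 then (1 : ℝ) else 0) + θ ^ 2 / 4 * (25 * (x.descFactorial 0 : ℕ)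
      - 24 * (x.descFactorial 1 : ℕ) + 12 * (x.descFactorial 2 : ℕ) - 4 * (x.descFactorial 3 : ℕ)
      + (x.descFactorial 4 : ℕ)) := by
  by_cases h : x = 0
  · subst h; simp; ring
  · rw [if_neg h]
    simp only [cast_df, Nat.descFactorial_zero]
    push_cast
    ring

theorem final_lower (n D : ℕ) (hn : 5 ≤ n) (hD : max 3 (n / 2) ≤ D) (d N c4 c5 : ℝ)
    (hd : 0 < d) (hc : (n = 5 ∧ c4 = 2 ∧ c5 = 2) ∨ (n = 6 ∧ c4 = 1 ∧ c5 = 2) ∨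
      (7 ≤ n ∧ c4 = 1 ∧ c5 = 1))
    (hdN : N * (1 / 3 + c4 / 24 - c5 / 120) ≤ d) :
    ((n : ℝ) - 1) ^ 2 * (N - (11 - c4) / 4 * d) < d * (D : ℝ) ^ 2 := by
  have hD3 : (3 : ℝ) ≤ D := by exact_mod_cast (le_max_left _ _).trans hD
  have hD9 : (9 : ℝ) ≤ (D : ℝ) ^ 2 := by nlinarith
  have h9 : d * 9 ≤ d * (D : ℝ) ^ 2 := mul_le_mul_of_nonneg_left hD9 hd.le
  rcases hc with ⟨h, h4, h5⟩ | ⟨h, h4, h5⟩ | ⟨h, h4, h5⟩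
  · subst h h4 h5
    norm_num at hdN ⊢
    linarith
  · subst h h4 h5
    norm_num at hdN ⊢
    linarith
  · subst h4 h5
    norm_num at hdN ⊢
    have hD2 : (n : ℝ) - 1 ≤ 2 * D := by
      have : n ≤ 2 * D + 1 := by have := (le_max_right 3 (n/2)).trans hD; omega
      have : (n : ℝ) ≤ 2 * D + 1 := by exact_mod_cast this
      linarith
    have hn1 : (6 : ℝ) ≤ (n : ℝ) - 1 := by
      have : (7 : ℝ) ≤ n := by exact_mod_cast h
      linarith
    have h1 : N - 5 / 2 * d ≤ 5 / 22 * d := by linarith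
    have h2 : ((n : ℝ) - 1) ^ 2 ≤ 4 * (D : ℝ) ^ 2 := by nlinarith
    calc ((n : ℝ) - 1) ^ 2 * (N - 5 / 2 * d) ≤ ((n : ℝ) - 1) ^ 2 * (5 / 22 * d) := by gcongr
      _ ≤ 4 * (D : ℝ) ^ 2 * (5 / 22 * d) := by gcongr
      _ < d * (D : ℝ) ^ 2 := by nlinarith [mul_pos hd (by positivity : (0 : ℝ) < (D : ℝ) ^ 2)]

theorem der_iff {n : ℕ} (σ : alternatingGroup (Fin n)) :
    (∀ i : Fin n, (σ : Equiv.Perm (Fin n)) i ≠ i) ↔ fixN σ = 0 := by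
  unfold fixN
  rw [Finset.card_eq_zero, Finset.filter_eq_empty_iff]
  simp

theorem moments {n : ℕ} (hn : 5 ≤ n) : ∃ c4 c5 : ℝ,
    ((n = 5 ∧ c4 = 2 ∧ c5 = 2) ∨ (n = 6 ∧ c4 = 1 ∧ c5 = 2) ∨ (7 ≤ n ∧ c4 = 1 ∧ c5 = 1)) ∧
    (∀ k ≤ 3, ∑ σ : alternatingGroup (Fin n), (((fixN σ).descFactorial k : ℕ) : ℝ) =
      Fintype.card (alternatingGroup (Fin n))) ∧
    ∑ σ : alternatingGroup (Fin n), (((fixN σ).descFactorial 4 : ℕ) : ℝ) =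
      Fintype.card (alternatingGroup (Fin n)) * c4 ∧
    ∑ σ : alternatingGroup (Fin n), (((fixN σ).descFactorial 5 : ℕ) : ℝ) =
      Fintype.card (alternatingGroup (Fin n)) * c5 := by
  have hlow : ∀ k ≤ n - 2, ∑ σ : alternatingGroup (Fin n), (((fixN σ).descFactorial k : ℕ) : ℝ) =
      Fintype.card (alternatingGroup (Fin n)) := fun k hk => by exact_mod_cast moment_low hk
  have hhigh : ∀ k, n - 1 ≤ k → k ≤ n →
      ∑ σ : alternatingGroup (Fin n), (((fixN σ).descFactorial k : ℕ) : ℝ) =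
      Fintype.card (alternatingGroup (Fin n)) * 2 := fun k hk hk' => by
    rw [mul_comm]; exact_mod_cast moment_high (by omega) hk hk'
  rcases (by omega : n = 5 ∨ n = 6 ∨ 7 ≤ n) with h | h | h
  · exact ⟨2, 2, Or.inl ⟨h, rfl, rfl⟩, fun k hk => hlow k (by omega),
      hhigh 4 (by omega) (by omega), hhigh 5 (by omega) (by omega)⟩
  · exact ⟨1, 2, Or.inr (Or.inl ⟨h, rfl, rfl⟩), fun k hk => hlow k (by omega),
      by rw [mul_one]; exact hlow 4 (by omega), hhigh 5 (by omega) (by omega)⟩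
  · exact ⟨1, 1, Or.inr (Or.inr ⟨h, rfl, rfl⟩), fun k hk => hlow k (by omega),
      by rw [mul_one]; exact hlow 4 (by omega), by rw [mul_one]; exact hlow 5 (by omega)⟩

/-- Real-variable core estimate. -/
theorem core (n : ℕ) (hn : 5 ≤ n) (D : ℕ) (hD : max 3 (n / 2) ≤ D) (d : ℝ)
    (hd : d = ∑ σ : alternatingGroup (Fin n), if fixN σ = 0 then (1 : ℝ) else 0)
    (r : alternatingGroup (Fin n) → ℝ)
    (hr : ∑ σ, (r σ) ^ 2 ≤ Fintype.card (alternatingGroup (Fin n)))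
    (h0 : ∑ σ, r σ * ((fixN σ).descFactorial 0 : ℕ) = 0)
    (h1 : ∑ σ, r σ * ((fixN σ).descFactorial 1 : ℕ) = 0)
    (h2 : 0 ≤ ∑ σ, r σ * ((fixN σ).descFactorial 2 : ℕ)) :
    0 < d ∧ -d / ((n : ℝ) - 1) * D < ∑ σ, r σ * (if fixN σ = 0 then (1 : ℝ) else 0) ∧
    ∑ σ, r σ * (if fixN σ = 0 then (1 : ℝ) else 0) < d * D := by
  obtain ⟨c4, c5, hc, hm, hm4, hm5⟩ := moments hn
  obtain ⟨N, hN⟩ : ∃ N : ℝ, N = ((Fintype.card (alternatingGroup (Fin n)) : ℕ) : ℝ) := ⟨_, rfl⟩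
  have hNpos : 0 < N := by
    rw [hN]; exact Nat.cast_pos.2 (Fintype.card_pos (α := alternatingGroup (Fin n)))
  rw [← hN] at hr hm4 hm5
  simp only [← hN] at hm
  have hD3 : (3 : ℝ) ≤ D := by exact_mod_cast (le_max_left _ _).trans hD
  set Z := ∑ σ, r σ * (if fixN σ = 0 then (1 : ℝ) else 0) with hZ
  have hdN : N * (1 / 3 + c4 / 24 - c5 / 120) ≤ d := by
    rw [hd]
    refine le_trans (le_of_eq ?_) (Finset.sum_le_sum fun σ _ => bonferroni (fixN σ))
    simp only [Finset.sum_add_distrib, Finset.sum_sub_distrib, ← Finset.sum_div]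
    rw [hm 0 (by norm_num), hm 1 (by norm_num), hm 2 (by norm_num), hm 3 (by norm_num), hm4, hm5]
    ring
  have hd3 : N * (1 / 3) < d := by
    refine lt_of_lt_of_le ?_ hdN
    rcases hc with ⟨_, h4, h5⟩ | ⟨_, h4, h5⟩ | ⟨_, h4, h5⟩ <;> subst h4 h5 <;> linarith
  have hdpos : 0 < d := lt_trans (by positivity) hd3
  set θ := d / N with hθ
  have hθN : θ * N = d := by rw [hθ]; field_simp
  have hn1 : (0 : ℝ) < (n : ℝ) - 1 := by
    have : (5 : ℝ) ≤ n := by exact_mod_cast hn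
    linarith
  have CS : ∀ F : alternatingGroup (Fin n) → ℝ, (∑ σ, F σ * r σ) ^ 2 ≤ (∑ σ, F σ ^ 2) * N := by
    intro F
    refine (Finset.sum_mul_sq_le_sq_mul_sq _ _ _).trans ?_
    exact mul_le_mul_of_nonneg_left hr (Finset.sum_nonneg fun _ _ => sq_nonneg _)
  refine ⟨hdpos, ?_, ?_⟩
  · have hcs := CS fun σ => (if fixN σ = 0 then (1 : ℝ) else 0) - θ * (5 / 2 * ((fixN σ).descFactorial 0 : ℕ)
      - 2 * ((fixN σ).descFactorial 1 : ℕ) + ((fixN σ).descFactorial 2 : ℕ) / 2)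
    simp only [sq_expand] at hcs
    rw [Finset.sum_add_distrib, ← Finset.mul_sum, ← Finset.mul_sum, ← hd] at hcs
    simp only [Finset.sum_add_distrib, Finset.sum_sub_distrib, ← Finset.mul_sum] at hcs
    rw [hm 0 (by norm_num), hm 1 (by norm_num), hm 2 (by norm_num), hm 3 (by norm_num), hm4] at hcs
    set A2 := ∑ σ, r σ * ((fixN σ).descFactorial 2 : ℕ) with hA2
    have hlhs : ∑ σ, ((if fixN σ = 0 then (1 : ℝ) else 0) - θ * (5 / 2 * ((fixN σ).descFactorial 0 : ℕ)
      - 2 * ((fixN σ).descFactorial 1 : ℕ) + ((fixN σ).descFactorial 2 : ℕ) / 2)) * r σ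
        = Z - θ / 2 * A2 := by
      have : Z - θ / 2 * A2 =
          Z - θ * (5 / 2) * (∑ σ, r σ * ((fixN σ).descFactorial 0 : ℕ))
            + θ * 2 * (∑ σ, r σ * ((fixN σ).descFactorial 1 : ℕ)) - θ / 2 * A2 := by
        rw [h0, h1]; ring
      rw [this, hZ, hA2]
      simp only [Finset.mul_sum, ← Finset.sum_add_distrib, ← Finset.sum_sub_distrib]
      apply Finset.sum_congr rfl
      intro σ _
      ring
    rw [hlhs] at hcs
    have hrhs : ((1 - 5 * θ) * d + θ ^ 2 / 4 * (25 * N - 24 * N + 12 * N - 4 * N + N * c4)) * N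
        = d * (N - (11 - c4) / 4 * d) := by
      rw [← hθN]; ring
    rw [hrhs] at hcs
    have hfin := final_lower n D hn hD d N c4 c5 hdpos hc hdN
    by_contra hcon
    push Not at hcon
    have hθpos : 0 ≤ θ := by positivity
    have h3 : Z - θ / 2 * A2 ≤ -(d / ((n : ℝ) - 1) * D) := by
      have : 0 ≤ θ / 2 * A2 := by positivity
      have e : -d / ((n : ℝ) - 1) * D = -(d / ((n : ℝ) - 1) * D) := by ring
      linarith
    have h4 : (d / ((n : ℝ) - 1) * D) ^ 2 ≤ (Z - θ / 2 * A2) ^ 2 := by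
      have : 0 ≤ d / ((n : ℝ) - 1) * D := by positivity
      nlinarith
    have h5 := h4.trans hcs
    have h6 : (d / ((n : ℝ) - 1) * D) ^ 2 = d * (d * (D : ℝ) ^ 2) / ((n : ℝ) - 1) ^ 2 := by
      field_simp
    rw [h6, div_le_iff₀ (by positivity)] at h5
    have h7 : d * (((n : ℝ) - 1) ^ 2 * (N - (11 - c4) / 4 * d)) < d * (d * (D : ℝ) ^ 2) :=
      mul_lt_mul_of_pos_left hfin hdpos
    linarith
  · have hcs := CS fun σ => (if fixN σ = 0 then (1 : ℝ) else 0)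
    have e1 : ∑ σ : alternatingGroup (Fin n), (if fixN σ = 0 then (1 : ℝ) else 0) ^ 2 = d := by
      rw [hd]; apply Finset.sum_congr rfl; intro σ _; split_ifs <;> norm_num
    have e2 : ∑ σ, (if fixN σ = 0 then (1 : ℝ) else 0) * r σ = Z := by
      rw [hZ]; apply Finset.sum_congr rfl; intro σ _; ring
    rw [e1, e2] at hcs
    by_contra hcon
    push Not at hcon
    have h3 : (d * 3) ≤ d * D := by gcongr
    nlinarith

/-- For `n ≥ 5`, the least eigenvalue `-d/(n-1)` of the derangement graph of
`Alt(n)` is afforded only by the standard character `ψ = fix - 1`, the largest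
eigenvalue `d` only by the trivial character, and every other irreducible
character gives an eigenvalue strictly in between. -/
theorem stmt11 (n : ℕ) (hn : 5 ≤ n)
    (d : ℕ)
    (hd : d = (Finset.univ.filter fun σ : alternatingGroup (Fin n) =>
      ∀ i : Fin n, (σ : Equiv.Perm (Fin n)) i ≠ i).card)
    (V : FDRep ℂ ↥(alternatingGroup (Fin n))) (hV : CategoryTheory.Simple V)
    (lam : ℂ)
    (hlam : lam =
      (∑ σ ∈ Finset.univ.filter fun σ : alternatingGroup (Fin n) =>
          ∀ i : Fin n, (σ : Equiv.Perm (Fin n)) i ≠ i,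
        V.character σ) / V.character 1) :
    (lam = -(d : ℂ) / ((n : ℂ) - 1) →
      ∀ σ : alternatingGroup (Fin n),
        V.character σ =
          ((Finset.univ.filter fun i : Fin n =>
            (σ : Equiv.Perm (Fin n)) i = i).card : ℂ) - 1) ∧
    (lam = (d : ℂ) →
      ∀ σ : alternatingGroup (Fin n), V.character σ = 1) ∧
    ((¬ ∀ σ : alternatingGroup (Fin n),
        V.character σ =
          ((Finset.univ.filter fun i : Fin n =>
            (σ : Equiv.Perm (Fin n)) i = i).card : ℂ) - 1) →
     (¬ ∀ σ : alternatingGroup (Fin n), V.character σ = 1) →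
     -(d : ℂ) / ((n : ℂ) - 1) < lam ∧ lam < (d : ℂ)) := by
  change (lam = -(d : ℂ) / ((n : ℂ) - 1) →
      ∀ σ : alternatingGroup (Fin n), V.character σ = (fixN σ : ℂ) - 1) ∧
    (lam = (d : ℂ) → ∀ σ : alternatingGroup (Fin n), V.character σ = 1) ∧
    ((¬ ∀ σ : alternatingGroup (Fin n), V.character σ = (fixN σ : ℂ) - 1) →
     (¬ ∀ σ : alternatingGroup (Fin n), V.character σ = 1) →
     -(d : ℂ) / ((n : ℂ) - 1) < lam ∧ lam < (d : ℂ))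
  -- basic facts on the numbers involved
  have hdsum : (d : ℝ) = ∑ σ : alternatingGroup (Fin n), if fixN σ = 0 then (1 : ℝ) else 0 := by
    rw [hd, Finset.sum_boole]
    simp only [der_iff]
  have hlam2 : lam = (∑ σ : alternatingGroup (Fin n),
      V.character σ * (((if fixN σ = 0 then (1 : ℝ) else 0) : ℝ) : ℂ)) / V.character 1 := by
    rw [hlam]
    congr 1
    simp only [der_iff]
    rw [Finset.sum_filter]
    apply Finset.sum_congr rfl
    intro σ _
    split_ifs <;> simp
  have hdsumC : (d : ℂ) = ∑ σ : alternatingGroup (Fin n),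
      (((if fixN σ = 0 then (1 : ℝ) else 0) : ℝ) : ℂ) := by
    have := congrArg (fun x : ℝ => (x : ℂ)) hdsum
    push_cast at this ⊢
    exact this
  obtain ⟨c4, c5, -, hm, -, -⟩ := moments hn
  -- positivity of d
  have hdpos : 0 < (d : ℝ) :=
    (core n hn (max 3 (n / 2)) le_rfl d hdsum (fun _ => 0) (by simp) (by simp) (by simp) (by simp)).1
  have hn1 : (4 : ℝ) ≤ (n : ℝ) - 1 := by
    have : (5 : ℝ) ≤ n := by exact_mod_cast hn
    linarith
  have hne : (d : ℂ) ≠ -(d : ℂ) / ((n : ℂ) - 1) := by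
    intro h
    have h' : (d : ℝ) = -(d : ℝ) / ((n : ℝ) - 1) := by exact_mod_cast h
    have : -(d : ℝ) / ((n : ℝ) - 1) ≤ 0 := div_nonpos_of_nonpos_of_nonneg (by linarith) (by linarith)
    linarith
  -- trivial and standard eigenvalues
  have htriv : (∀ σ : alternatingGroup (Fin n), V.character σ = 1) → lam = d := by
    intro h
    rw [hlam2]
    simp only [h, one_mul, div_one]
    exact hdsumC.symm
  have hstd : (∀ σ : alternatingGroup (Fin n), V.character σ = (fixN σ : ℂ) - 1) →
      lam = -(d : ℂ) / ((n : ℂ) - 1) := by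
    intro h
    rw [hlam2, h 1, fixN_one, hdsumC]
    congr 1
    rw [← Finset.sum_neg_distrib]
    apply Finset.sum_congr rfl
    intro σ _
    rw [h σ]
    split_ifs with h0 <;> simp [h0]
  -- main part
  have main : (¬ ∀ σ : alternatingGroup (Fin n), V.character σ = (fixN σ : ℂ) - 1) →
     (¬ ∀ σ : alternatingGroup (Fin n), V.character σ = 1) →
     -(d : ℂ) / ((n : ℂ) - 1) < lam ∧ lam < (d : ℂ) := by
    intro hns hnt
    have hnorm := sum_normSq_char V hV
    have hfix : ∀ k, ∃ m : ℕ, ∑ σ : alternatingGroup (Fin n),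
        V.character σ * (((fixN σ).descFactorial k : ℕ) : ℂ) =
        (Fintype.card (alternatingGroup (Fin n)) : ℂ) * m := by
      intro k
      obtain ⟨m, hmm⟩ := sum_char_fixed (X := Fin k ↪ Fin n) V.ρ
      refine ⟨m, ?_⟩
      rw [← hmm]
      apply Finset.sum_congr rfl
      intro σ _
      rw [← card_fixedBy_emb k σ]
      congr!
    obtain ⟨a0, ha0⟩ := hfix 0
    obtain ⟨a1, ha1⟩ := hfix 1
    obtain ⟨a2, ha2⟩ := hfix 2
    have ha0' : a0 = 0 := by
      refine (eq_of_inner V.character (fun _ => 1) hnorm (by simp) a0 ?_).resolve_right ?_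
      · simpa using ha0
      · simpa using hnt
    subst ha0'
    have ha1' : a1 = 0 := by
      refine (eq_of_inner V.character (fun σ => (fixN σ : ℝ) - 1) hnorm ?_ a1 ?_).resolve_right ?_
      · have e : ∀ σ : alternatingGroup (Fin n), ((fixN σ : ℝ) - 1) ^ 2 =
            ((fixN σ).descFactorial 2 : ℕ) - ((fixN σ).descFactorial 1 : ℕ) +
              ((fixN σ).descFactorial 0 : ℕ) := by
          intro σ
          simp only [cast_df, Nat.descFactorial_zero]
          push_cast
          ring
        simp only [e, Finset.sum_add_distrib, Finset.sum_sub_distrib]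
        rw [hm 0 (by norm_num), hm 1 (by norm_num), hm 2 (by norm_num)]
        ring
      · rw [← ha1]
        have : ∑ σ : alternatingGroup (Fin n),
            V.character σ * (((fixN σ).descFactorial 1 : ℕ) : ℂ) =
            ∑ σ : alternatingGroup (Fin n), V.character σ * (((fixN σ).descFactorial 1 : ℕ) : ℂ) -
            ∑ σ : alternatingGroup (Fin n), V.character σ * (((fixN σ).descFactorial 0 : ℕ) : ℂ) := by
          rw [ha0]; simp
        rw [this, ← Finset.sum_sub_distrib]
        apply Finset.sum_congr rfl
        intro σ _
        simp
        ring
      · simpa using hns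
    subst ha1'
    have hD : max 3 (n / 2) ≤ Module.finrank ℂ V := by
      refine dim_bound n hn V V.ρ ?_
      by_contra hcon
      push Not at hcon
      have hch : ∀ σ, V.character σ = Module.finrank ℂ V := by
        intro σ
        rw [← FDRep.char_one]
        unfold FDRep.character
        rw [hcon σ, hcon 1]
      have hz : (Module.finrank ℂ V : ℂ) = 0 := by
        have := ha0
        simp only [hch, Nat.descFactorial_zero, Nat.cast_one, mul_one, Finset.sum_const,
          Finset.card_univ, nsmul_eq_mul, Nat.cast_zero, mul_zero] at this
        exact (mul_eq_zero.1 this).resolve_left (Nat.cast_ne_zero.2 Fintype.card_ne_zero)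
      have h2 := hnorm
      simp only [hch, hz, map_zero, Finset.sum_const_zero] at h2
      exact absurd h2.symm (Nat.cast_ne_zero.2 Fintype.card_ne_zero)
    have hre : ∀ k (m : ℕ), ∑ σ : alternatingGroup (Fin n),
        V.character σ * (((fixN σ).descFactorial k : ℕ) : ℂ) =
        (Fintype.card (alternatingGroup (Fin n)) : ℂ) * m →
        ∑ σ : alternatingGroup (Fin n), (V.character σ).re * (((fixN σ).descFactorial k : ℕ) : ℝ) =
        (Fintype.card (alternatingGroup (Fin n)) : ℝ) * m := by
      intro k m h
      have := congrArg Complex.re h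
      simpa using this
    obtain ⟨-, hlo, hhi⟩ := core n hn (Module.finrank ℂ V) hD d hdsum (fun σ => (V.character σ).re)
      (by
        rw [← hnorm]
        apply Finset.sum_le_sum
        intro σ _
        rw [Complex.normSq_apply]
        nlinarith [mul_self_nonneg (V.character σ).im])
      (by rw [hre 0 0 ha0]; simp) (by rw [hre 1 0 ha1]; simp)
      (by rw [hre 2 a2 ha2]; positivity)
    -- the eigenvalue is real
    set Z : ℂ := ∑ σ : alternatingGroup (Fin n),
      V.character σ * (((if fixN σ = 0 then (1 : ℝ) else 0) : ℝ) : ℂ) with hZ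
    have hfinv : ∀ σ : alternatingGroup (Fin n), fixN σ⁻¹ = fixN σ := by
      intro σ
      unfold fixN
      congr 1
      apply Finset.filter_congr
      intro i _
      show (σ : Equiv.Perm (Fin n))⁻¹ i = i ↔ _
      rw [Equiv.Perm.inv_eq_iff_eq, eq_comm]
    have hZim : star Z = Z := by
      rw [hZ, star_sum, ← Equiv.sum_comp (Equiv.inv (alternatingGroup (Fin n)))]
      apply Finset.sum_congr rfl
      intro σ _
      have hc : V.character σ⁻¹ = star (V.character σ) := trace_inv_conj V.ρ σ
      simp only [Equiv.inv_apply, hc, hfinv, star_mul', star_star]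
      congr 1
      exact Complex.conj_ofReal _
    have hZre : Z = ((∑ σ : alternatingGroup (Fin n), (V.character σ).re *
        (if fixN σ = 0 then (1 : ℝ) else 0) : ℝ) : ℂ) := by
      have h1 : (Z.re : ℂ) = Z := Complex.conj_eq_iff_re.1 hZim
      rw [← h1, hZ, Complex.re_sum]
      congr 1
      apply Finset.sum_congr rfl
      intro σ _
      rw [Complex.re_mul_ofReal]
    set z : ℝ := ∑ σ : alternatingGroup (Fin n), (V.character σ).re *
        (if fixN σ = 0 then (1 : ℝ) else 0) with hz
    have hDpos : (0 : ℝ) < (Module.finrank ℂ V : ℝ) := by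
      have : 3 ≤ Module.finrank ℂ V := (le_max_left _ _).trans hD
      exact_mod_cast (by omega : 0 < Module.finrank ℂ V)
    have hlamr : lam = ((z / (Module.finrank ℂ V : ℝ) : ℝ) : ℂ) := by
      rw [hlam2, hZre, FDRep.char_one]
      push_cast
      rfl
    constructor
    · rw [hlamr]
      have : -(d : ℝ) / ((n : ℝ) - 1) < z / (Module.finrank ℂ V : ℝ) := by
        rw [lt_div_iff₀ hDpos]; exact hlo
      exact_mod_cast this
    · rw [hlamr]
      have : z / (Module.finrank ℂ V : ℝ) < (d : ℝ) := by
        rw [div_lt_iff₀ hDpos]; exact hhi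
      exact_mod_cast this
  refine ⟨?_, ?_, main⟩
  · intro h
    by_contra hns
    by_cases hnt : ∀ σ : alternatingGroup (Fin n), V.character σ = 1
    · exact hne ((htriv hnt).symm.trans h)
    · exact (main hns hnt).1.ne h.symm
  · intro h
    by_contra hnt
    by_cases hns : ∀ σ : alternatingGroup (Fin n), V.character σ = (fixN σ : ℂ) - 1
    · exact hne (h.symm.trans (hstd hns))
    · exact (main hns hnt).2.ne h
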